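/- Let W be the Coxeter group of type D₄ on generators s₁,s₂,s₃,s₄ (with s₂ the branch node), and let u = (s₁s₂s₃s₄)³ be its longest element, a central involution. Then H²(W/⟨u⟩, ℂˣ) is isomorphic to ℤ/2 × ℤ/2 × ℤ/2. -/

import Mathlib

variable (k : Type*) [Field k] (G : Type*) [Group G]

/-- A normalized 2-cocycle on `G` with values in `kˣ` (trivial `G`-action):
`σ(g,h)σ(gh,l) = σ(h,l)σ(g,hl)` and `σ(1,g) = σ(g,1) = 1`. -/
def IsCocycle (σ : G → G → kˣ) : Prop :=
  (∀ g h l : G, σ g h * σ (g * h) l = σ h l * σ g (h * l)) ∧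
    (∀ g : G, σ 1 g = 1) ∧ (∀ g : G, σ g 1 = 1)

/-- A 2-coboundary: `∂γ(g,h) = γ(g)γ(h)γ(gh)⁻¹` for some `γ` with `γ(1) = 1`. -/
def IsCoboundary (σ : G → G → kˣ) : Prop :=
  ∃ γ : G → kˣ, γ 1 = 1 ∧ ∀ g h : G, σ g h = γ g * γ h * (γ (g * h))⁻¹

/-- The group `Z²(G,kˣ)` of 2-cocycles, as a subgroup of the pointwise product group. -/
def Z2 : Subgroup (G → G → kˣ) where
  carrier := {σ | IsCocycle k G σ}
  one_mem' := ⟨fun _ _ _ => by simp, fun _ => rfl, fun _ => rfl⟩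
  mul_mem' := by
    rintro σ ω ⟨hσ1, hσ2, hσ3⟩ ⟨hω1, hω2, hω3⟩
    refine ⟨fun g h l => ?_, fun g => ?_, fun g => ?_⟩
    · simp only [Pi.mul_apply]
      rw [mul_mul_mul_comm, hσ1 g h l, hω1 g h l, mul_mul_mul_comm]
    · simp only [Pi.mul_apply, hσ2 g, hω2 g, one_mul]
    · simp only [Pi.mul_apply, hσ3 g, hω3 g, one_mul]
  inv_mem' := by
    rintro σ ⟨h1, h2, h3⟩
    refine ⟨fun g h l => ?_, fun g => ?_, fun g => ?_⟩
    · simp only [Pi.inv_apply]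
      rw [← mul_inv, ← mul_inv, h1 g h l]
    · simp only [Pi.inv_apply, h2 g, inv_one]
    · simp only [Pi.inv_apply, h3 g, inv_one]

/-- The subgroup `B²(G,kˣ)` of 2-coboundaries inside `Z²(G,kˣ)`. -/
def B2 : Subgroup (Z2 k G) where
  carrier := {σ | IsCoboundary k G (σ : G → G → kˣ)}
  one_mem' := ⟨fun _ => 1, rfl, fun g h => by simp⟩
  mul_mem' := by
    rintro σ ω ⟨γ, hγ1, hγ⟩ ⟨δ, hδ1, hδ⟩
    refine ⟨γ * δ, by simp [hγ1, hδ1], fun g h => ?_⟩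
    show (σ : G → G → kˣ) g h * (ω : G → G → kˣ) g h = _
    rw [hγ g h, hδ g h]
    simp only [Pi.mul_apply, mul_inv]
    ac_rfl
  inv_mem' := by
    rintro σ ⟨γ, hγ1, hγ⟩
    refine ⟨γ⁻¹, by simp [hγ1], fun g h => ?_⟩
    show ((σ : G → G → kˣ) g h)⁻¹ = _
    rw [hγ g h]
    simp only [Pi.inv_apply, mul_inv, inv_inv]

/-- The second cohomology group `H²(G,kˣ) = Z²(G,kˣ)/B²(G,kˣ)` with its usual
(pointwise-multiplication-induced) group structure. -/
abbrev H2 := Z2 k G ⧸ B2 k G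

/-- The relations `(sᵢsⱼ)^{m i j} = 1` of a Coxeter presentation (with `m i i = 1`,
so that the generators are involutions). -/
def coxeterRels {n : ℕ} (m : Fin n → Fin n → ℕ) : Set (FreeGroup (Fin n)) :=
  ⋃ (i : Fin n) (j : Fin n), {(FreeGroup.of i * FreeGroup.of j) ^ m i j}

/-- The Coxeter group presented by the matrix `m`. -/
abbrev CoxGroup {n : ℕ} (m : Fin n → Fin n → ℕ) := PresentedGroup (coxeterRels m)

/-- The simple reflections. -/
def coxS {n : ℕ} (m : Fin n → Fin n → ℕ) (i : Fin n) : CoxGroup m := PresentedGroup.of i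

/-- The Coxeter element `s₁ s₂ ⋯ sₙ`. -/
def coxProd {n : ℕ} (m : Fin n → Fin n → ℕ) : CoxGroup m :=
  (List.ofFn fun i => coxS m i).prod

/-- The Coxeter matrix of type `D₄` with branch node `s₂` (index 1). -/
def mD4 : Fin 4 → Fin 4 → ℕ := fun i j =>
  if i = j then 1 else if i = 1 ∨ j = 1 then 3 else 2

/-- Word computation in type `D₄`: the cube of the Coxeter element is a commutator. -/
theorem wordD4 {M : Type*} [Monoid M] (a b c d : M) (hac : ∀ z, a * (c * z) = c * (a * z))
    (had : ∀ z, a * (d * z) = d * (a * z)) (hcd : ∀ z, c * (d * z) = d * (c * z))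
    (hab : ∀ z, a * (b * (a * z)) = b * (a * (b * z)))
    (hcb : ∀ z, c * (b * (c * z)) = b * (c * (b * z)))
    (hdb : ∀ z, d * (b * (d * z)) = b * (d * (b * z))) (z : M) :
    a * (b * (c * (d * (a * (b * (c * (d * (a * (b * (c * (d * z))))))))))) =
      c * (d * (b * (a * (c * (b * (d * (c * (b * (c * (a * (b * z))))))))))) := by
  have hca := fun z => (hac z).symm
  have hda := fun z => (had z).symm
  have hdc := fun z => (hcd z).symm
  have hba := fun z => (hab z).symm
  have hbc := fun z => (hcb z).symm
  have hbd := fun z => (hdb z).symm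
  rw [hcd (a * (b * (c * (d * (a * (b * (c * (d * z)))))))),
    hda (b * (c * (d * z))),
    hca (d * (b * (c * (d * z)))),
    hab (c * (d * (b * (c * (d * z))))),
    hcd (z),
    hdb (c * z),
    hbc (d * (b * (c * z))),
    hac (b * (c * (d * (b * (c * z))))),
    hcb (a * (b * (c * (d * (b * (c * z)))))),
    hbd (c * (b * (a * (b * (c * (d * (b * (c * z)))))))),
    had (b * (d * (c * (b * (a * (b * (c * (d * (b * (c * z)))))))))),
    hdc (b * (a * (b * (c * (d * (b * (c * z))))))),
    hba (c * (d * (b * (c * z)))),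
    hda (b * (a * (c * (d * (b * (c * z)))))),
    hcd (b * (c * z)),
    had (c * (b * (c * z))),
    hdb (a * (c * (b * (c * z)))),
    hcb (z),
    hba (c * (b * z)),
    hda (b * (a * (c * (b * z)))),
    hab (d * (b * (a * (c * (b * z))))),
    hbc (a * (b * (d * (b * (a * (c * (b * z))))))),
    hac (b * (c * (a * (b * (d * (b * (a * (c * (b * z))))))))),
    hdc (a * (b * (c * (a * (b * (d * (b * (a * (c * (b * z)))))))))),
    hca (b * (d * (b * (a * (c * (b * z)))))),
    hab (c * (b * (d * (b * (a * (c * (b * z))))))),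
    hbc (d * (b * (a * (c * (b * z))))),
    hcd (b * (a * (c * (b * z)))),
    hac (b * z)]

/-! ### Splitting criterion for central extensions -/

/-- Generator of the quotient group. -/
abbrev gQ (u : CoxGroup mD4) [(Subgroup.zpowers u).Normal] (i : Fin 4) :
    CoxGroup mD4 ⧸ Subgroup.zpowers u := QuotientGroup.mk (coxS mD4 i)

theorem coxS_rel (i j : Fin 4) : (coxS mD4 i * coxS mD4 j) ^ mD4 i j = 1 := by
  have h : (FreeGroup.of i * FreeGroup.of j) ^ mD4 i j ∈ coxeterRels mD4 := by
    simp only [coxeterRels, Set.mem_iUnion]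
    exact ⟨i, j, rfl⟩
  have := PresentedGroup.one_of_mem h
  rw [map_pow, map_mul] at this
  exact this

theorem coxS_sq (i : Fin 4) : coxS mD4 i * coxS mD4 i = 1 := by
  simpa [mD4] using coxS_rel i i

theorem coxS_comm (i j : Fin 4) (hij : mD4 i j = 2) :
    coxS mD4 i * coxS mD4 j = coxS mD4 j * coxS mD4 i := by
  have h := coxS_rel i j
  have hi := coxS_sq i
  have hj := coxS_sq j
  rw [hij, pow_two] at h
  calc coxS mD4 i * coxS mD4 j
      = (coxS mD4 i * coxS mD4 j) * ((coxS mD4 j * coxS mD4 j)) * 1 := by rw [hj]; simp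
    _ = (coxS mD4 i * coxS mD4 j) * ((coxS mD4 j * coxS mD4 j)) *
          (coxS mD4 i * coxS mD4 i) := by rw [hi]
    _ = (coxS mD4 i * (coxS mD4 j * coxS mD4 j) * coxS mD4 i) *
          (coxS mD4 i * coxS mD4 j * (coxS mD4 i * coxS mD4 j)) *
          (coxS mD4 j * coxS mD4 i) := by
        rw [hj, h]
        simp only [mul_one, one_mul, hi]
        have : coxS mD4 j * coxS mD4 i = (coxS mD4 i * coxS mD4 j)⁻¹ := by
          rw [mul_inv_rev, inv_eq_of_mul_eq_one_left hi, inv_eq_of_mul_eq_one_left hj]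
        rw [this]
        exact eq_inv_of_mul_eq_one_left h
    _ = coxS mD4 j * coxS mD4 i := by rw [hj, h]; simp [hi]

theorem coxS_braid (i j : Fin 4) (hij : mD4 i j = 3) :
    coxS mD4 i * (coxS mD4 j * coxS mD4 i) = coxS mD4 j * (coxS mD4 i * coxS mD4 j) := by
  have h := coxS_rel i j
  have hi := inv_eq_of_mul_eq_one_left (coxS_sq i)
  have hj := inv_eq_of_mul_eq_one_left (coxS_sq j)
  rw [hij, pow_succ, pow_two] at h
  have : coxS mD4 i * (coxS mD4 j * coxS mD4 i) =
      (coxS mD4 j * (coxS mD4 i * coxS mD4 j))⁻¹ := by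
    apply eq_inv_of_mul_eq_one_left
    simpa only [mul_assoc] using h
  rw [this, mul_inv_rev, mul_inv_rev, hi, hj, mul_assoc]

theorem coxProd_eq : coxProd mD4 ^ 3 =
    (coxS mD4 2 * coxS mD4 3) * (coxS mD4 1 * coxS mD4 0 * coxS mD4 2 * coxS mD4 1) *
    (coxS mD4 2 * coxS mD4 3)⁻¹ * (coxS mD4 1 * coxS mD4 0 * coxS mD4 2 * coxS mD4 1)⁻¹ := by
  have hc : ∀ i j, mD4 i j = 2 → ∀ z, coxS mD4 i * (coxS mD4 j * z) =
      coxS mD4 j * (coxS mD4 i * z) := fun i j h z => by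
    rw [← mul_assoc, coxS_comm i j h, mul_assoc]
  have hb : ∀ i j, mD4 i j = 3 → ∀ z, coxS mD4 i * (coxS mD4 j * (coxS mD4 i * z)) =
      coxS mD4 j * (coxS mD4 i * (coxS mD4 j * z)) := fun i j h z => by
    have := congrArg (· * z) (coxS_braid i j h)
    simpa only [mul_assoc] using this
  have hinv : ∀ i, (coxS mD4 i)⁻¹ = coxS mD4 i := fun i =>
    inv_eq_of_mul_eq_one_left (coxS_sq i)
  have := wordD4 (coxS mD4 0) (coxS mD4 1) (coxS mD4 2) (coxS mD4 3)
    (hc _ _ rfl) (hc _ _ rfl) (hc _ _ rfl) (hb _ _ rfl) (hb _ _ rfl) (hb _ _ rfl) 1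
  simp only [mul_one] at this
  simp only [mul_inv_rev, hinv, coxProd, pow_succ, pow_zero, one_mul, mul_assoc]
  simpa [List.ofFn_succ, mul_assoc] using this

theorem exists_sqrt_units (c : ℂˣ) : ∃ w : ℂˣ, w * w = c := by
  obtain ⟨z, hz⟩ := IsAlgClosed.exists_pow_nat_eq (c : ℂ) (n := 2) (by norm_num)
  have hz0 : z ≠ 0 := by
    rintro rfl
    exact c.ne_zero (by rw [← hz]; simp)
  refine ⟨Units.mk0 z hz0, Units.ext ?_⟩
  simpa [pow_two] using hz

section split
variable {Q E : Type*} [Group Q] [Group E] (pr : E →* Q) (ι : ℂˣ →* E)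

theorem lift_sq (hc : ∀ c e, Commute (ι c) e) (hk : ∀ e, pr e = 1 → ∃ c, e = ι c)
    (hι : ∀ c, pr (ι c) = 1) (hs : Function.Surjective pr) (s : Q) (h : s * s = 1) :
    ∃ T, pr T = s ∧ T * T = 1 := by
  obtain ⟨T, rfl⟩ := hs s
  obtain ⟨c, hcT⟩ := hk (T * T) (by rw [map_mul, h])
  obtain ⟨w, hw⟩ := exists_sqrt_units c⁻¹
  refine ⟨ι w * T, by rw [map_mul, hι, one_mul], ?_⟩
  rw [(hc w T).symm.mul_mul_mul_comm, hcT, ← map_mul, hw, ← map_mul]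
  simp

theorem lift_braid (hc : ∀ c e, Commute (ι c) e) (hk : ∀ e, pr e = 1 → ∃ c, e = ι c)
    (hι : ∀ c, pr (ι c) = 1) (hs : Function.Surjective pr) (s : Q) (h : s * s = 1)
    (B : E) (hB : B * B = 1) (h3 : (s * pr B) ^ 3 = 1) :
    ∃ T, pr T = s ∧ T * T = 1 ∧ (T * B) ^ 3 = 1 ∧ (B * T) ^ 3 = 1 := by
  obtain ⟨T, rfl, hT⟩ := lift_sq pr ι hc hk hι hs s h
  obtain ⟨c, hcT⟩ := hk ((T * B) ^ 3) (by rw [map_pow, map_mul, h3])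
  have hTi := inv_eq_of_mul_eq_one_left hT
  have hBi := inv_eq_of_mul_eq_one_left hB
  have hinv : (B * T) = (T * B)⁻¹ := by rw [mul_inv_rev, hTi, hBi]
  have hconj : (B * T) ^ 3 = ι c := by
    have e1 : (B * T) ^ 3 = T * (T * B) ^ 3 * T⁻¹ := by
      rw [← conj_pow]
      congr 1
      rw [hTi, ← mul_assoc, hT, one_mul]
    rw [e1, hcT, ← (hc c T).eq, mul_inv_cancel_right]
  have hcc : ι c * ι c = 1 := by
    nth_rewrite 1 [← hconj]
    rw [← hcT, hinv, inv_pow, inv_mul_cancel]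
  have hc3 : ι c ^ 3 = ι c := by rw [pow_succ, pow_two, hcc, one_mul]
  have h1 : (ι c * T * B) ^ 3 = 1 := by
    rw [mul_assoc, (hc c (T * B)).mul_pow, hcT, hc3, hcc]
  refine ⟨ι c * T, by rw [map_mul, hι, one_mul], ?_, h1, ?_⟩
  · rw [(hc c T).symm.mul_mul_mul_comm, hT, hcc, one_mul]
  · rw [← mul_assoc, ← (hc c B).eq, mul_assoc, (hc c (B * T)).mul_pow, hconj, hc3, hcc]

theorem commute_congr (hc : ∀ c e, Commute (ι c) e) (hk : ∀ e, pr e = 1 → ∃ c, e = ι c)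
    {P P' X : E} (h : pr P = pr P') (hP : Commute X P) : Commute X P' := by
  obtain ⟨c, hcc⟩ := hk (P' * P⁻¹) (by rw [map_mul, map_inv, h, mul_inv_cancel])
  rw [← inv_mul_cancel_right P' P, hcc] 
  exact ((hc c X).symm).mul_right hP

theorem split_exists (u : CoxGroup mD4) (hu : u = coxProd mD4 ^ 3)
    [hn : (Subgroup.zpowers u).Normal]
    (pr : E →* (CoxGroup mD4 ⧸ Subgroup.zpowers u))
    (hc : ∀ c e, Commute (ι c) e) (hk : ∀ e, pr e = 1 → ∃ c, e = ι c)
    (hι : ∀ c, pr (ι c) = 1) (hs : Function.Surjective pr)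
    (h1 : ∀ X Y, pr X = gQ u 0 → pr Y = gQ u 2 → Commute X Y)
    (h2 : ∀ X Y, pr X = gQ u 0 → pr Y = gQ u 3 → Commute X Y)
    (h3 : ∀ X Y, pr X = gQ u 2 * gQ u 3 → pr Y = gQ u 1 * gQ u 0 * gQ u 2 * gQ u 1 →
      Commute X Y) :
    ∃ F : (CoxGroup mD4 ⧸ Subgroup.zpowers u) →* E, ∀ q, pr (F q) = q := by
  have sq : ∀ i, gQ u i * gQ u i = 1 := fun i => by
    rw [← QuotientGroup.mk_mul, coxS_sq]; rfl
  have br : ∀ i j, mD4 i j = 3 → (gQ u i * gQ u j) ^ 3 = 1 := fun i j h => by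
    rw [← QuotientGroup.mk_mul, ← QuotientGroup.mk_pow, ← h, coxS_rel]; rfl
  obtain ⟨B, hB, hB2⟩ := lift_sq pr ι hc hk hι hs _ (sq 1)
  obtain ⟨A, hA, hA2, hAB, hBA⟩ := lift_braid pr ι hc hk hι hs _ (sq 0) B hB2
    (by rw [hB]; exact br 0 1 rfl)
  obtain ⟨C, hC, hC2, hCB, hBC⟩ := lift_braid pr ι hc hk hι hs _ (sq 2) B hB2
    (by rw [hB]; exact br 2 1 rfl)
  obtain ⟨D, hD, hD2, hDB, hBD⟩ := lift_braid pr ι hc hk hι hs _ (sq 3) B hB2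
    (by rw [hB]; exact br 3 1 rfl)
  have hAC := h1 A C hA hC
  have hAD := h2 A D hA hD
  have hXY := h3 (C * D) (B * A * C * B) (by rw [map_mul, hC, hD])
    (by simp only [map_mul, hA, hB, hC])
  set Y := B * A * C * B with hY
  have hYpr : pr Y = gQ u 1 * gQ u 0 * gQ u 2 * gQ u 1 := by
    simp only [hY, map_mul, hA, hB, hC]
  -- the conjugate of `C` by `Y` lies over `s₁`
  have hconj : pr (Y * C * Y⁻¹) = pr A := by
    have : Y * C * Y⁻¹ = Y * C * Y⁻¹ := rfl
    rw [map_mul, map_mul, map_inv, hYpr, hC, hA, mul_inv_eq_iff_eq_mul]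
    have e : coxS mD4 1 * coxS mD4 0 * coxS mD4 2 * coxS mD4 1 * coxS mD4 2 =
        coxS mD4 0 * (coxS mD4 1 * coxS mD4 0 * coxS mD4 2 * coxS mD4 1) := by
      have b1 := coxS_braid 2 1 rfl
      have b2 := coxS_braid 0 1 rfl
      calc _ = coxS mD4 1 * coxS mD4 0 * (coxS mD4 2 * (coxS mD4 1 * coxS mD4 2)) := by
            simp only [mul_assoc]
        _ = coxS mD4 1 * (coxS mD4 0 * coxS mD4 1) * coxS mD4 2 * coxS mD4 1 := by
            rw [b1]; simp only [mul_assoc]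
        _ = _ := by rw [← b2]; simp only [mul_assoc]
    have := congrArg (QuotientGroup.mk (s := Subgroup.zpowers u)) e
    simpa only [QuotientGroup.mk_mul] using this
  have hCD : Commute C D := by
    have k1 : Commute A (C * D) := hAC.mul_right hAD
    have k2 : Commute A (Y * (C * D) * Y⁻¹) := by
      rw [← hXY.eq, mul_inv_cancel_right]; exact k1
    have k3 : Commute A (Y * C * Y⁻¹) :=
      commute_congr pr ι hc hk hconj.symm (Commute.refl A)
    have k4 : Commute A (Y * D * Y⁻¹) := by
      have : Y * D * Y⁻¹ = (Y * C * Y⁻¹)⁻¹ * (Y * (C * D) * Y⁻¹) := by group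
      rw [this]; exact k3.inv_right.mul_right k2
    have k5 : Commute (Y * C * Y⁻¹) (Y * D * Y⁻¹) :=
      (commute_congr pr ι hc hk hconj.symm k4.symm).symm
    exact (Commute.conj_iff Y).1 k5
  let t : Fin 4 → E := ![A, B, C, D]
  have cm : ∀ {x y : E}, Commute x y → x * x = 1 → y * y = 1 → (x * y) ^ 2 = 1 := by
    intro x y hxy hx hy
    rw [hxy.mul_pow, pow_two, pow_two, hx, hy, one_mul]
  have hrel : ∀ r ∈ coxeterRels mD4, FreeGroup.lift t r = 1 := by
    intro r hr
    simp only [coxeterRels, Set.mem_iUnion, Set.mem_singleton_iff] at hr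
    obtain ⟨i, j, rfl⟩ := hr
    rw [map_pow, map_mul, FreeGroup.lift_apply_of, FreeGroup.lift_apply_of]
    fin_cases i <;> fin_cases j
    · simpa [mD4, t] using hA2
    · exact hAB
    · exact cm hAC hA2 hC2
    · exact cm hAD hA2 hD2
    · exact hBA
    · simpa [mD4, t] using hB2
    · exact hBC
    · exact hBD
    · exact cm hAC.symm hC2 hA2
    · exact hCB
    · simpa [mD4, t] using hC2
    · exact cm hCD hC2 hD2
    · exact cm hAD.symm hD2 hA2
    · exact hDB
    · exact cm hCD.symm hD2 hC2
    · simpa [mD4, t] using hD2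
  let f : CoxGroup mD4 →* E := PresentedGroup.toGroup hrel
  have hf : ∀ i, f (coxS mD4 i) = t i := fun i => PresentedGroup.toGroup.of hrel
  have hfu : f u = 1 := by
    rw [hu, coxProd_eq]
    simp only [map_mul, map_inv, hf]
    change (C * D) * Y * (C * D)⁻¹ * Y⁻¹ = 1
    rw [hXY.eq, mul_inv_cancel_right, mul_inv_cancel]
  let F : (CoxGroup mD4 ⧸ Subgroup.zpowers u) →* E := QuotientGroup.lift _ f (by
    intro x hx
    have : Subgroup.zpowers u ≤ f.ker := by
      rw [Subgroup.zpowers_le]; exact hfu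
    exact this hx)
  refine ⟨F, fun q => ?_⟩
  have hpf : (pr.comp f) = QuotientGroup.mk' (Subgroup.zpowers u) := by
    apply PresentedGroup.ext
    intro i
    change pr (f (coxS mD4 i)) = gQ u i
    rw [hf]
    fin_cases i
    · exact hA
    · exact hB
    · exact hC
    · exact hD
  obtain ⟨w, rfl⟩ := QuotientGroup.mk_surjective q
  exact DFunLike.congr_fun hpf w

end split

/-! ### The central extension attached to a cocycle -/

section ext
variable {Q : Type*} [Group Q]

/-- Underlying set of the central extension of `Q` by `ℂˣ` attached to a cocycle. -/
@[ext] structure CExt (σ : Z2 ℂ Q) where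
  /-- component in the group -/
  fst : Q
  /-- scalar component -/
  snd : ℂˣ

variable (σ : Z2 ℂ Q)

instance : Mul (CExt σ) := ⟨fun p q => ⟨p.fst * q.fst, p.snd * q.snd * σ.1 p.fst q.fst⟩⟩
instance : One (CExt σ) := ⟨⟨1, 1⟩⟩
instance : Inv (CExt σ) := ⟨fun p => ⟨p.fst⁻¹, (p.snd * σ.1 p.fst⁻¹ p.fst)⁻¹⟩⟩

theorem CExt.mul_def (p q : CExt σ) :
    p * q = ⟨p.fst * q.fst, p.snd * q.snd * σ.1 p.fst q.fst⟩ := rfl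
theorem CExt.one_def : (1 : CExt σ) = ⟨1, 1⟩ := rfl
theorem CExt.inv_def (p : CExt σ) :
    p⁻¹ = ⟨p.fst⁻¹, (p.snd * σ.1 p.fst⁻¹ p.fst)⁻¹⟩ := rfl

instance : Group (CExt σ) := Group.ofLeftAxioms
  (by
    intro p q r
    obtain ⟨h1, -, -⟩ := σ.2
    ext1
    · simp [CExt.mul_def, mul_assoc]
    · simp only [CExt.mul_def]
      have := h1 p.fst q.fst r.fst
      calc p.snd * q.snd * σ.1 p.fst q.fst * r.snd * σ.1 (p.fst * q.fst) r.fst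
          = p.snd * q.snd * r.snd * (σ.1 p.fst q.fst * σ.1 (p.fst * q.fst) r.fst) := by ac_rfl
        _ = _ := by rw [this]; ac_rfl)
  (by
    intro p
    obtain ⟨-, h1, -⟩ := σ.2
    ext1
    · simp [CExt.mul_def, CExt.one_def]
    · simp [CExt.mul_def, CExt.one_def, h1 p.fst])
  (by
    intro p
    ext1
    · simp [CExt.mul_def, CExt.one_def, CExt.inv_def]
    · simp [CExt.mul_def, CExt.one_def, CExt.inv_def])

/-- Projection. -/
def CExt.pr : CExt σ →* Q where
  toFun := CExt.fst
  map_one' := rfl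
  map_mul' _ _ := rfl

/-- Scalars. -/
def CExt.sc : ℂˣ →* CExt σ where
  toFun c := ⟨1, c⟩
  map_one' := rfl
  map_mul' a b := by
    obtain ⟨-, h1, -⟩ := σ.2
    ext1
    · simp [CExt.mul_def]
    · simp [CExt.mul_def, h1 1]

theorem CExt.sc_comm (c : ℂˣ) (e : CExt σ) : Commute (CExt.sc σ c) e := by
  obtain ⟨-, h1, h2⟩ := σ.2
  change CExt.sc σ c * e = e * CExt.sc σ c
  ext1
  · simp [CExt.mul_def, CExt.sc]
  · simp [CExt.mul_def, CExt.sc, h1 e.fst, h2 e.fst, mul_comm]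

theorem CExt.ker_pr (e : CExt σ) (h : CExt.pr σ e = 1) : ∃ c, e = CExt.sc σ c :=
  ⟨e.snd, CExt.ext h rfl⟩

theorem CExt.sc_inj : Function.Injective (CExt.sc σ) := fun _ _ h => congrArg CExt.snd h

theorem CExt.commute_of (X Y : CExt σ) (h : X.fst * Y.fst = Y.fst * X.fst)
    (hσ : σ.1 X.fst Y.fst = σ.1 Y.fst X.fst) : Commute X Y := by
  change X * Y = Y * X
  ext1
  · exact h
  · simp only [CExt.mul_def]
    rw [hσ, mul_comm X.snd]

/-- The commutator pairing of a cocycle at `x, y`. -/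
noncomputable def pairing (x y : Q) : Z2 ℂ Q →* ℂˣ where
  toFun σ := σ.1 x y * (σ.1 y x)⁻¹
  map_one' := by simp
  map_mul' σ τ := by
    simp only [Subgroup.coe_mul, Pi.mul_apply, mul_inv]
    ac_rfl

theorem pairing_B2 (x y : Q) (hxy : x * y = y * x) (σ : Z2 ℂ Q) (h : σ ∈ B2 ℂ Q) :
    pairing x y σ = 1 := by
  obtain ⟨γ, -, hγ⟩ := h
  change σ.1 x y * (σ.1 y x)⁻¹ = 1
  rw [mul_inv_eq_one, hγ, hγ, hxy, mul_comm (γ x)]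

theorem pairing_sq (x y : Q) (hxy : x * y = y * x) (hx : x * x = 1) (σ : Z2 ℂ Q) :
    pairing x y σ * pairing x y σ = 1 := by
  set b := pairing x y σ with hb
  let X : CExt σ := ⟨x, 1⟩
  let Y : CExt σ := ⟨y, 1⟩
  have h1 : X * Y = CExt.sc σ b * (Y * X) := by
    obtain ⟨-, h1, -⟩ := σ.2
    ext1
    · simpa [CExt.mul_def, CExt.sc, X, Y] using hxy
    · simp [CExt.mul_def, CExt.sc, X, Y, h1 (y * x), hb, pairing]
  obtain ⟨c, hc⟩ := CExt.ker_pr σ (X * X) hx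
  have h2 : (X * X) * Y = CExt.sc σ (b * b) * (Y * (X * X)) := by
    rw [mul_assoc, h1, ← mul_assoc X, ← (CExt.sc_comm σ b X).eq, mul_assoc, ← mul_assoc X, h1,
      map_mul]
    simp only [mul_assoc]
  rw [hc, ← (CExt.sc_comm σ c Y).eq] at h2
  apply CExt.sc_inj σ
  rw [map_one]
  exact (mul_eq_right.1 h2.symm)

theorem B2_of_split (F : Q →* CExt σ) (hF : ∀ q, CExt.pr σ (F q) = q) : σ ∈ B2 ℂ Q := by
  have hF' : ∀ q, (F q).fst = q := hF
  refine ⟨fun q => (F q).snd⁻¹, by simp [CExt.one_def], fun g h => ?_⟩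
  have := congrArg CExt.snd (F.map_mul g h)
  rw [CExt.mul_def] at this
  simp only [hF'] at this
  change _ = (F g).snd⁻¹ * (F h).snd⁻¹ * ((F (g * h)).snd⁻¹)⁻¹
  rw [this, inv_inv]
  have e : ∀ a b c : ℂˣ, c = a⁻¹ * b⁻¹ * (a * b * c) := fun a b c => by
    rw [← mul_inv, inv_mul_cancel_left]
  exact e _ _ _

end ext

/-! ### Cocycles from projective representations -/

section construct
variable {Q Γ : Type*} [Group Q] [Group Γ]

theorem exists_cocycle (ι : ℤˣ →* Γ) (hι : Function.Injective ι)
    (hc : ∀ c e, Commute (ι c) e) [hN : ι.range.Normal] (ρ : Q →* Γ ⧸ ι.range) :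
    ∃ σ : Z2 ℂ Q, ∀ (x y : Q) (X Y : Γ) (e : ℤˣ), x * y = y * x → 
      QuotientGroup.mk X = ρ x → QuotientGroup.mk Y = ρ y → X * Y = ι e * (Y * X) →
      pairing x y σ = Units.map (Int.castRingHom ℂ).toMonoidHom e := by
  classical
  have hex : ∃ r : Q → Γ, r 1 = 1 ∧ ∀ q, (QuotientGroup.mk (r q) : Γ ⧸ ι.range) = ρ q := by
    refine ⟨fun q => if q = 1 then 1 else Quotient.out (ρ q), by simp, fun q => ?_⟩
    by_cases h : q = 1
    · simp [h]
    · simp only [h, if_false]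
      exact QuotientGroup.out_eq' _
  obtain ⟨r, hr1, hr⟩ := hex
  have hmem : ∀ {a b : Γ}, (QuotientGroup.mk a : Γ ⧸ ι.range) = QuotientGroup.mk b →
      ∃ e : ℤˣ, a = ι e * b := by
    intro a b hab
    obtain ⟨e, he⟩ := QuotientGroup.eq.1 hab.symm
    exact ⟨e, by rw [(hc e b).eq, he, mul_inv_cancel_left]⟩
  have hs : ∀ g h, ∃ e : ℤˣ, r g * r h = ι e * r (g * h) := fun g h => by
    apply hmem
    rw [QuotientGroup.mk_mul, hr, hr, hr, map_mul]
  choose s hs using hs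
  have key : ∀ {a b : ℤˣ} {t : Γ}, ι a * t = ι b * t → a = b := fun h =>
    hι (mul_right_cancel h)
  have coc : ∀ g h l, s g h * s (g * h) l = s h l * s g (h * l) := fun g h l => by
    apply key (t := r (g * h * l))
    rw [map_mul, map_mul, mul_assoc, ← hs, ← mul_assoc, ← hs, mul_assoc (r g), hs h l,
      ← mul_assoc, ← (hc (s h l) (r g)).eq, mul_assoc, hs g (h * l), mul_assoc g, mul_assoc]
  have n1 : ∀ g, s 1 g = 1 := fun g => by
    apply key (t := r g)
    have := hs 1 g
    rw [hr1, one_mul, one_mul] at this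
    rw [← this, map_one, one_mul]
  have n2 : ∀ g, s g 1 = 1 := fun g => by
    apply key (t := r g)
    have := hs g 1
    rw [hr1, mul_one, mul_one] at this
    rw [← this, map_one, one_mul]
  let χ : ℤˣ →* ℂˣ := Units.map (Int.castRingHom ℂ).toMonoidHom
  refine ⟨⟨fun g h => χ (s g h), ?_, ?_, ?_⟩, ?_⟩
  · intro g h l
    simp only [← map_mul, coc]
  · intro g
    simp only [n1, map_one]
  · intro g
    simp only [n2, map_one]
  · intro x y X Y e hxy hX hY hXY
    change χ (s x y) * (χ (s y x))⁻¹ = χ e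
    rw [mul_inv_eq_iff_eq_mul, ← map_mul]
    congr 1
    obtain ⟨a, ha⟩ := hmem ((hr x).trans hX.symm)
    obtain ⟨b, hb⟩ := hmem ((hr y).trans hY.symm)
    have e1 : r x * r y = ι (a * b) * (X * Y) := by
      rw [ha, hb, (hc b X).symm.mul_mul_mul_comm, map_mul]
    have e2 : r y * r x = ι (a * b) * (Y * X) := by
      rw [ha, hb, (hc a Y).symm.mul_mul_mul_comm, mul_comm a b, map_mul]
    apply key (t := r (x * y))
    rw [← hs, e1, hXY, ← mul_assoc, ← map_mul, mul_comm _ e, map_mul ι e, map_mul ι e, mul_assoc,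
      ← e2, hs, ← hxy, mul_assoc]

theorem exists_cocycle_D4 (u : CoxGroup mD4) (hu : u = coxProd mD4 ^ 3)
    [hn : (Subgroup.zpowers u).Normal]
    (ι : ℤˣ →* Γ) (hι : Function.Injective ι)
    (hc : ∀ c e, Commute (ι c) e) (t : Fin 4 → Γ)
    (hsq : ∀ i j, ∃ e, (t i * t j) ^ mD4 i j = ι e) (e : ℤˣ)
    (he : (t 2 * t 3) * (t 1 * t 0 * t 2 * t 1) =
      ι e * ((t 1 * t 0 * t 2 * t 1) * (t 2 * t 3))) :
    ∃ σ : Z2 ℂ (CoxGroup mD4 ⧸ Subgroup.zpowers u),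
      (∀ i j a, gQ u i * gQ u j = gQ u j * gQ u i → t i * t j = ι a * (t j * t i) →
        pairing (gQ u i) (gQ u j) σ = Units.map (Int.castRingHom ℂ).toMonoidHom a) ∧
      ((gQ u 2 * gQ u 3) * (gQ u 1 * gQ u 0 * gQ u 2 * gQ u 1) =
        (gQ u 1 * gQ u 0 * gQ u 2 * gQ u 1) * (gQ u 2 * gQ u 3) →
        pairing (gQ u 2 * gQ u 3) (gQ u 1 * gQ u 0 * gQ u 2 * gQ u 1) σ =
        Units.map (Int.castRingHom ℂ).toMonoidHom e) := by
  have hN : ι.range.Normal := ⟨by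
    rintro _ ⟨c, rfl⟩ g
    exact ⟨c, by rw [← (hc c g).eq, mul_inv_cancel_right]⟩⟩
  let π : Γ →* Γ ⧸ ι.range := QuotientGroup.mk' _
  have hπ : ∀ c, π (ι c) = 1 := fun c => (QuotientGroup.eq_one_iff _).2 ⟨c, rfl⟩
  have hrel : ∀ r ∈ coxeterRels mD4, FreeGroup.lift (fun i => π (t i)) r = 1 := by
    intro r hr
    simp only [coxeterRels, Set.mem_iUnion, Set.mem_singleton_iff] at hr
    obtain ⟨i, j, rfl⟩ := hr
    rw [map_pow, map_mul, FreeGroup.lift_apply_of, FreeGroup.lift_apply_of]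
    obtain ⟨e, he⟩ := hsq i j
    rw [← map_mul, ← map_pow, he, hπ]
  let f : CoxGroup mD4 →* Γ ⧸ ι.range := PresentedGroup.toGroup hrel
  have hf : ∀ i, f (coxS mD4 i) = π (t i) := fun i => PresentedGroup.toGroup.of hrel
  have hfu : f u = 1 := by
    rw [hu, coxProd_eq]
    have := congrArg π he
    rw [map_mul π (ι e), hπ, one_mul] at this
    simp only [map_mul] at this
    simp only [map_mul, map_inv, hf]
    rw [this, ← map_mul π, ← map_mul π, ← map_mul π, mul_inv_rev]
    simp only [map_mul]
    group
  let F : (CoxGroup mD4 ⧸ Subgroup.zpowers u) →* Γ ⧸ ι.range := QuotientGroup.lift _ f (by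
    intro x hx
    have : Subgroup.zpowers u ≤ f.ker := by
      rw [Subgroup.zpowers_le]; exact hfu
    exact this hx)
  have hF : ∀ i, F (gQ u i) = π (t i) := hf
  obtain ⟨σ, hσ⟩ := exists_cocycle ι hι hc F
  refine ⟨σ, fun i j a hij ha => ?_, fun h => ?_⟩
  · exact hσ _ _ (t i) (t j) a hij (hF i).symm (hF j).symm ha
  · refine hσ _ _ (t 2 * t 3) (t 1 * t 0 * t 2 * t 1) e h ?_ ?_ he
    · simp only [map_mul, hF]; rfl
    · simp only [map_mul, hF]; rfl

end construct

/-! ### Explicit matrices over `ZMod 3` -/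

/-- The scalars `±1` in a ring. -/
abbrev sgnR (R : Type*) [Ring R] : ℤˣ →* Rˣ := Units.map (Int.castRingHom R).toMonoidHom

theorem sgnR_comm (R : Type*) [Ring R] (c : ℤˣ) (e : Rˣ) : Commute (sgnR R c) e := by
  apply Units.ext
  exact Int.cast_commute _ _

theorem sgnR_neg_one (R : Type*) [Ring R] : sgnR R (-1) = -1 := by
  apply Units.ext; simp

theorem sgnR_inj (R : Type*) [Ring R] (h : (-1 : R) ≠ 1) : Function.Injective (sgnR R) := by
  have h' : (-1 : Rˣ) ≠ 1 := fun h1 => h (by simpa using congrArg Units.val h1)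
  intro a b hab
  rcases Int.units_eq_one_or a with rfl | rfl <;> rcases Int.units_eq_one_or b with rfl | rfl
  · rfl
  · rw [sgnR_neg_one, map_one] at hab; exact absurd hab.symm h'
  · rw [sgnR_neg_one, map_one] at hab; exact absurd hab h'
  · rfl

abbrev M2 := Matrix (Fin 2) (Fin 2) (ZMod 3)
abbrev M4 := Matrix (Fin 4) (Fin 4) (ZMod 3)

def mA : M2ˣ := ⟨!![1, 0; 0, 2], !![1, 0; 0, 2], by decide, by decide⟩
def mB : M2ˣ := ⟨!![0, 1; 1, 0], !![0, 1; 1, 0], by decide, by decide⟩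
def mC : M2ˣ := ⟨!![1, 1; 0, 2], !![1, 1; 0, 2], by decide, by decide⟩

def r1 : M4ˣ := ⟨!![0,1,0,0; 1,0,0,0; 0,0,1,0; 0,0,0,1], !![0,1,0,0; 1,0,0,0; 0,0,1,0; 0,0,0,1],
  by decide +kernel, by decide +kernel⟩
def r2 : M4ˣ := ⟨!![1,0,0,0; 0,0,1,0; 0,1,0,0; 0,0,0,1], !![1,0,0,0; 0,0,1,0; 0,1,0,0; 0,0,0,1],
  by decide +kernel, by decide +kernel⟩
def r3 : M4ˣ := ⟨!![1,0,0,0; 0,1,0,0; 0,0,0,1; 0,0,1,0], !![1,0,0,0; 0,1,0,0; 0,0,0,1; 0,0,1,0],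
  by decide +kernel, by decide +kernel⟩
def r4 : M4ˣ := ⟨!![1,0,0,0; 0,1,0,0; 0,0,0,2; 0,0,2,0], !![1,0,0,0; 0,1,0,0; 0,0,0,2; 0,0,2,0],
  by decide +kernel, by decide +kernel⟩

theorem rel13 : ∀ i j, ∃ e, (![mA, mC, mA, mB] i * ![mA, mC, mA, mB] j) ^ mD4 i j =
    sgnR M2 e := by
  decide +kernel

theorem rel14 : ∀ i j, ∃ e, (![mA, mC, mB, mA] i * ![mA, mC, mB, mA] j) ^ mD4 i j =
    sgnR M2 e := by
  decide +kernel

theorem relW : ∀ i j, ∃ e, (![r1, r2, r3, r4] i * ![r1, r2, r3, r4] j) ^ mD4 i j =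
    sgnR M4 e := by
  decide +kernel

/-! ### Assembly -/

/-- Signs as complex units. -/
noncomputable abbrev sgnC : ℤˣ →* ℂˣ := Units.map (Int.castRingHom ℂ).toMonoidHom

/-- The isomorphism of `ℤ/2` with the group of signs. -/
def sgnZ : Multiplicative (ZMod 2) →* ℤˣ where
  toFun a := if a = 1 then 1 else -1
  map_one' := by decide
  map_mul' := by decide

theorem sgnZ_inj : ∀ a b, sgnZ a = sgnZ b → a = b := by decide

theorem sgnZ_surj : ∀ e, ∃ a, sgnZ a = e := by decide

theorem exists_sgnC (c : ℂˣ) (h : c * c = 1) : ∃ e, sgnC e = c := by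
  have h' : (c : ℂ) * c = 1 := by simpa using congrArg Units.val h
  rcases mul_self_eq_one_iff.1 h' with h | h
  · exact ⟨1, Units.ext (by simp [h])⟩
  · exact ⟨-1, Units.ext (by simp [h])⟩

theorem sgnC_inj : Function.Injective sgnC := sgnR_inj ℂ (by norm_num)

/-- The embedding of `(ℤ/2)³` in `(ℂˣ)³`. -/
noncomputable def embJ : Multiplicative (ZMod 2 × ZMod 2 × ZMod 2) →* ℂˣ × ℂˣ × ℂˣ where
  toFun v := (sgnC (sgnZ (Multiplicative.ofAdd v.toAdd.1)),
    sgnC (sgnZ (Multiplicative.ofAdd v.toAdd.2.1)),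
    sgnC (sgnZ (Multiplicative.ofAdd v.toAdd.2.2)))
  map_one' := by simp
  map_mul' v w := by
    simp only [toAdd_mul, Prod.fst_add, Prod.snd_add, ofAdd_add, map_mul, Prod.mk_mul_mk]

theorem embJ_inj : Function.Injective embJ := by
  intro v w h
  simp only [embJ, MonoidHom.coe_mk, OneHom.coe_mk, Prod.mk.injEq] at h
  obtain ⟨h1, h2, h3⟩ := h
  have k1 := sgnZ_inj _ _ (sgnC_inj h1)
  have k2 := sgnZ_inj _ _ (sgnC_inj h2)
  have k3 := sgnZ_inj _ _ (sgnC_inj h3)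
  apply Multiplicative.toAdd.injective
  exact Prod.ext k1 (Prod.ext k2 k3)

theorem embJ_surj (a b c : ℤˣ) : ∃ v, embJ v = (sgnC a, sgnC b, sgnC c) := by
  obtain ⟨a, rfl⟩ := sgnZ_surj a
  obtain ⟨b, rfl⟩ := sgnZ_surj b
  obtain ⟨c, rfl⟩ := sgnZ_surj c
  exact ⟨Multiplicative.ofAdd (a.toAdd, b.toAdd, c.toAdd), rfl⟩

/-- Let `W` be the Coxeter group of type `D₄` (branch node `s₂`) and
`u = (s₁s₂s₃s₄)³` its longest element, a central involution. Then
`H²(W/⟨u⟩, ℂˣ) ≅ ℤ/2 × ℤ/2 × ℤ/2`. -/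
theorem statement14 (u : CoxGroup mD4) (hu : u = coxProd mD4 ^ 3)
    (hcen : ∀ w, u * w = w * u) (h2 : u ^ 2 = 1)
    [hn : (Subgroup.zpowers u).Normal] :
    Nonempty (H2 ℂ (CoxGroup mD4 ⧸ Subgroup.zpowers u) ≃*
      Multiplicative (ZMod 2 × ZMod 2 × ZMod 2)) := by
  set x := gQ u 2 * gQ u 3 with hx
  set y := gQ u 1 * gQ u 0 * gQ u 2 * gQ u 1 with hy
  have c02 : gQ u 0 * gQ u 2 = gQ u 2 * gQ u 0 :=
    congrArg (QuotientGroup.mk (s := Subgroup.zpowers u)) (coxS_comm 0 2 rfl)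
  have c03 : gQ u 0 * gQ u 3 = gQ u 3 * gQ u 0 :=
    congrArg (QuotientGroup.mk (s := Subgroup.zpowers u)) (coxS_comm 0 3 rfl)
  have c23 : gQ u 2 * gQ u 3 = gQ u 3 * gQ u 2 :=
    congrArg (QuotientGroup.mk (s := Subgroup.zpowers u)) (coxS_comm 2 3 rfl)
  have sq : ∀ i, gQ u i * gQ u i = 1 := fun i =>
    congrArg (QuotientGroup.mk (s := Subgroup.zpowers u)) (coxS_sq i)
  have cxy : x * y = y * x := by
    have h : x * y * x⁻¹ * y⁻¹ = 1 := by
      have h1 : (QuotientGroup.mk u : CoxGroup mD4 ⧸ Subgroup.zpowers u) = 1 :=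
        (QuotientGroup.eq_one_iff u).2 (Subgroup.mem_zpowers u)
      have h3 := congrArg (QuotientGroup.mk (s := Subgroup.zpowers u)) (hu.trans coxProd_eq)
      exact h3.symm.trans h1
    rw [mul_inv_eq_one, mul_inv_eq_iff_eq_mul] at h
    exact h
  have xx : x * x = 1 := by
    have : Commute (gQ u 2) (gQ u 3) := c23
    rw [hx, this.symm.mul_mul_mul_comm, sq, sq, one_mul]
  let φ : Z2 ℂ (CoxGroup mD4 ⧸ Subgroup.zpowers u) →* ℂˣ × ℂˣ × ℂˣ :=
    (pairing (gQ u 0) (gQ u 2)).prod ((pairing (gQ u 0) (gQ u 3)).prod (pairing x y))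
  have hφ : ∀ σ, φ σ = (pairing (gQ u 0) (gQ u 2) σ, pairing (gQ u 0) (gQ u 3) σ,
    pairing x y σ) := fun σ => rfl
  have hφB : ∀ σ ∈ B2 ℂ (CoxGroup mD4 ⧸ Subgroup.zpowers u), φ σ = 1 := fun σ hσ => by
    rw [hφ, pairing_B2 _ _ c02 σ hσ, pairing_B2 _ _ c03 σ hσ, pairing_B2 _ _ cxy σ hσ]
    rfl
  have hφker : ∀ σ, φ σ = 1 → σ ∈ B2 ℂ (CoxGroup mD4 ⧸ Subgroup.zpowers u) := by
    intro σ hσ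
    rw [hφ, Prod.mk_eq_one, Prod.mk_eq_one] at hσ
    obtain ⟨k1, k2, k3⟩ := hσ
    obtain ⟨F, hF⟩ := split_exists (CExt.sc σ) u hu (CExt.pr σ) (CExt.sc_comm σ)
      (CExt.ker_pr σ) (fun c => rfl) (fun q => ⟨⟨q, 1⟩, rfl⟩)
      (by
        rintro ⟨_, _⟩ ⟨_, _⟩ rfl rfl
        exact CExt.commute_of σ _ _ c02 (mul_inv_eq_one.1 k1))
      (by
        rintro ⟨_, _⟩ ⟨_, _⟩ rfl rfl
        exact CExt.commute_of σ _ _ c03 (mul_inv_eq_one.1 k2))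
      (by
        rintro ⟨_, _⟩ ⟨_, _⟩ rfl rfl
        exact CExt.commute_of σ _ _ cxy (mul_inv_eq_one.1 k3))
    exact B2_of_split σ F hF
  -- explicit cocycles
  have n2 : Function.Injective (sgnR M2) := sgnR_inj M2 (by decide)
  have n4 : Function.Injective (sgnR M4) := sgnR_inj M4 (by decide +kernel)
  obtain ⟨σ1, p1, q1⟩ := exists_cocycle_D4 u hu (sgnR M2) n2 (sgnR_comm M2)
    ![mA, mC, mB, mA] rel14 (-1) (by decide +kernel)
  obtain ⟨σ2, p2, q2⟩ := exists_cocycle_D4 u hu (sgnR M2) n2 (sgnR_comm M2)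
    ![mA, mC, mA, mB] rel13 1 (by decide +kernel)
  obtain ⟨σ3, p3, q3⟩ := exists_cocycle_D4 u hu (sgnR M4) n4 (sgnR_comm M4)
    ![r1, r2, r3, r4] relW (-1) (by decide +kernel)
  have v1 : φ σ1 = (sgnC (-1), 1, sgnC (-1)) := by
    rw [hφ, p1 0 2 (-1) c02 (by decide +kernel), p1 0 3 1 c03 (by decide +kernel), q1 cxy, map_one]
  have v2 : φ σ2 = (1, sgnC (-1), 1) := by
    rw [hφ, p2 0 2 1 c02 (by decide +kernel), p2 0 3 (-1) c03 (by decide +kernel), q2 cxy, map_one]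
  have v3 : φ σ3 = (1, 1, sgnC (-1)) := by
    rw [hφ, p3 0 2 1 c02 (by decide +kernel), p3 0 3 1 c03 (by decide +kernel), q3 cxy, map_one]
  have w1 : φ (σ1 * σ3) = (sgnC (-1), 1, 1) := by
    rw [map_mul, v1, v3, Prod.mk_mul_mk, Prod.mk_mul_mk, ← map_mul]
    simp
  have surj : ∀ a b c : ℤˣ, ∃ τ, φ τ = (sgnC a, sgnC b, sgnC c) := by
    intro a b c
    have t1 : ∃ τ, φ τ = (sgnC a, 1, 1) := by
      rcases Int.units_eq_one_or a with rfl | rfl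
      · exact ⟨1, by rw [map_one, map_one]; rfl⟩
      · exact ⟨_, w1⟩
    have t2 : ∃ τ, φ τ = (1, sgnC b, 1) := by
      rcases Int.units_eq_one_or b with rfl | rfl
      · exact ⟨1, by rw [map_one, map_one]; rfl⟩
      · exact ⟨_, v2⟩
    have t3 : ∃ τ, φ τ = (1, 1, sgnC c) := by
      rcases Int.units_eq_one_or c with rfl | rfl
      · exact ⟨1, by rw [map_one, map_one]; rfl⟩
      · exact ⟨_, v3⟩
    obtain ⟨τ1, h1⟩ := t1
    obtain ⟨τ2, h2⟩ := t2
    obtain ⟨τ3, h3⟩ := t3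
    refine ⟨τ1 * τ2 * τ3, ?_⟩
    rw [map_mul, map_mul, h1, h2, h3]
    simp only [Prod.mk_mul_mk, one_mul, mul_one]
  let ψ : H2 ℂ (CoxGroup mD4 ⧸ Subgroup.zpowers u) →* ℂˣ × ℂˣ × ℂˣ :=
    QuotientGroup.lift (B2 ℂ (CoxGroup mD4 ⧸ Subgroup.zpowers u)) φ hφB
  have hψ : Function.Injective ψ := by
    rw [injective_iff_map_eq_one]
    intro q hq
    obtain ⟨σ, rfl⟩ := QuotientGroup.mk_surjective q
    exact (QuotientGroup.eq_one_iff σ).2 (hφker σ hq)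
  have hrange : ψ.range = embJ.range := by
    apply le_antisymm
    · rintro _ ⟨q, rfl⟩
      obtain ⟨σ, rfl⟩ := QuotientGroup.mk_surjective q
      obtain ⟨a, ha⟩ := exists_sgnC _ (pairing_sq _ _ c02 (sq 0) σ)
      obtain ⟨b, hb⟩ := exists_sgnC _ (pairing_sq _ _ c03 (sq 0) σ)
      obtain ⟨c, hc⟩ := exists_sgnC _ (pairing_sq _ _ cxy xx σ)
      obtain ⟨v, hv⟩ := embJ_surj a b c
      refine ⟨v, ?_⟩
      rw [hv, ha, hb, hc]
      rfl
    · rintro _ ⟨v, rfl⟩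
      obtain ⟨τ, hτ⟩ := surj (sgnZ (Multiplicative.ofAdd v.toAdd.1))
        (sgnZ (Multiplicative.ofAdd v.toAdd.2.1)) (sgnZ (Multiplicative.ofAdd v.toAdd.2.2))
      exact ⟨QuotientGroup.mk τ, hτ⟩
  exact ⟨(MonoidHom.ofInjective hψ).trans
    ((MulEquiv.subgroupCongr hrange).trans (MonoidHom.ofInjective embJ_inj).symm)⟩
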